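/- Let A ⊆ ℕ and let ℓ, m be positive integers with k = m/ℓ. Then there exist a Borel probability measure μ on Σ × Σ that is invariant and ergodic for S × S, an open set E ⊆ Σ, points a'', a ∈ Σ, and a Følner sequence Φ in ℕ, such that (a'', a) is (S × S)-generic for μ along Φ, and (ℓ+m)·μ(Σ × E) + ℓ·μ(E × Σ) ≥ (2ℓ+m)·((k+1)·d̄(A) − k). Moreover A = {n ∈ ℕ : S^n a ∈ E} and {n ∈ ℕ : n(ℓ+m) ∈ A} = {n ∈ ℕ : S^{ℓn} a'' ∈ E}. -/

import Mathlib

open Filter MeasureTheory Topology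

open scoped Classical in
/-- Upper Banach density: `limsup` over window length `N` of the maximal count of
elements of `A` in a window of length `N`, divided by `N`. -/
noncomputable def upperBanachDensity (A : Set ℕ) : ℝ :=
  Filter.limsup
    (fun N : ℕ => ⨆ M : ℕ, (((Finset.Ico M (M + N)).filter (· ∈ A)).card : ℝ) / N)
    Filter.atTop

open scoped Classical in
/-- Natural upper density of a set of naturals. -/
noncomputable def upperDensity (A : Set ℕ) : ℝ :=
  Filter.limsup (fun N : ℕ => (((Finset.Icc 1 N).filter (· ∈ A)).card : ℝ) / N)
    Filter.atTop

open scoped Classical in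
/-- Natural lower density of a set of naturals. -/
noncomputable def lowerDensity (A : Set ℕ) : ℝ :=
  Filter.liminf (fun N : ℕ => (((Finset.Icc 1 N).filter (· ∈ A)).card : ℝ) / N)
    Filter.atTop

/-- A Følner sequence in `ℕ`. -/
def IsFolnerSeq (Φ : ℕ → Finset ℕ) : Prop :=
  (∀ N, (Φ N).Nonempty) ∧
  ∀ t : ℕ, Filter.Tendsto
    (fun N => ((Φ N ∩ (Φ N).image (fun n => t + n)).card : ℝ) / ((Φ N).card : ℝ))
    Filter.atTop (nhds 1)

/-- `a` is `T`-generic for `μ` along the Følner sequence `Φ`: the empirical measures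
along orbits converge to `μ` in the weak* topology. -/
def GenericAlong {X : Type*} [TopologicalSpace X] [MeasurableSpace X]
    (T : X → X) (μ : MeasureTheory.Measure X) (a : X) (Φ : ℕ → Finset ℕ) : Prop :=
  ∀ f : C(X, ℝ), Filter.Tendsto
    (fun N => (∑ n ∈ Φ N, f (T^[n] a)) / ((Φ N).card : ℝ))
    Filter.atTop (nhds (∫ x, f x ∂μ))

/-- `(x₀, x₁, x₂)` is an `(ℓ,m)`-Erdős progression for `T`. -/
def ErdosProg {X : Type*} [TopologicalSpace X] (T : X → X) (ℓ m : ℕ)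
    (x₀ x₁ x₂ : X) : Prop :=
  ∃ n : ℕ → ℕ, StrictMono n ∧ (∀ i, 0 < n i) ∧
    Filter.Tendsto (fun i => (T^[ℓ * n i] x₀, T^[m * n i] x₁)) Filter.atTop
      (nhds (x₁, x₂))

/-- The space `Σ = {0,1}^ℤ` (with the product topology). -/
abbrev BinSeq := ℤ → Bool

/-- The shift transformation `S` on `{0,1}^ℤ`, `S(x)(n) = x(n+1)`. -/
def shiftS : BinSeq → BinSeq := fun x n => x (n + 1)


section General

set_option linter.unusedSectionVars false

variable {X : Type*} [TopologicalSpace X] [CompactSpace X] [T2Space X]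
  [SecondCountableTopology X] [MeasurableSpace X] [BorelSpace X]

/-- Invariant means supported on the forward orbit closure of `x`. -/
def invMeans (T : C(X, X)) (x : X) : Set (C(X, ℝ) → ℝ) :=
  {L | (∀ f g, L (f + g) = L f + L g) ∧ (∀ (c : ℝ) f, L (c • f) = c * L f) ∧
    (∀ f : C(X, ℝ), L (f.comp T) = L f) ∧
    ∀ (f : C(X, ℝ)) (I : ℝ), (∀ n : ℕ, I ≤ f (T^[n] x)) → I ≤ L f}

lemma invMeans_one {T : C(X, X)} {x : X} {L : C(X, ℝ) → ℝ} (hL : L ∈ invMeans T x) :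
    L 1 = 1 := by
  obtain ⟨h1, h2, h3, h4⟩ := hL
  apply le_antisymm
  · have := h4 ((-1 : ℝ) • 1) (-1) (by intro n; simp)
    rw [h2] at this
    linarith
  · exact h4 1 1 (by intro n; simp)

lemma invMeans_compact (T : C(X, X)) (x : X) : IsCompact (invMeans T x) := by
  have hc : IsCompact (Set.pi Set.univ (fun f : C(X, ℝ) => Set.Icc (-‖f‖) ‖f‖)) :=
    isCompact_univ_pi (fun f => isCompact_Icc)
  refine hc.of_isClosed_subset ?_ ?_
  · have : invMeans T x = (⋂ f, ⋂ g, {L : C(X, ℝ) → ℝ | L (f + g) = L f + L g}) ∩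
      (⋂ c : ℝ, ⋂ f, {L : C(X, ℝ) → ℝ | L (c • f) = c * L f}) ∩
      (⋂ f : C(X, ℝ), {L : C(X, ℝ) → ℝ | L (f.comp T) = L f}) ∩
      (⋂ f : C(X, ℝ), ⋂ I : ℝ, ⋂ _ : (∀ n : ℕ, I ≤ f (T^[n] x)), {L : C(X, ℝ) → ℝ | I ≤ L f}) := by
      ext L
      simp [invMeans, and_assoc]
    rw [this]
    refine ((IsClosed.inter ?_ ?_).inter ?_).inter ?_
    · exact isClosed_iInter fun f => isClosed_iInter fun g =>
        isClosed_eq (by fun_prop) (by fun_prop)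
    · exact isClosed_iInter fun f => isClosed_iInter fun g =>
        isClosed_eq (by fun_prop) (by fun_prop)
    · exact isClosed_iInter fun f => isClosed_eq (by fun_prop) (by fun_prop)
    · exact isClosed_iInter fun f => isClosed_iInter fun I => isClosed_iInter fun _ =>
        isClosed_le (by fun_prop) (by fun_prop)
  · rintro L ⟨h1, h2, h3, h4⟩ f -
    constructor
    · exact h4 f _ (fun n => (abs_le.1 (f.norm_coe_le_norm _)).1)
    · have := h4 ((-1 : ℝ) • f) (-‖f‖) (fun n => by
        have := (abs_le.1 (f.norm_coe_le_norm (T^[n] x))).2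
        simpa using this)
      rw [h2] at this
      linarith

lemma integrable_cont (μ : Measure X) [IsFiniteMeasure μ] (f : C(X, ℝ)) :
    Integrable (fun x => f x) μ :=
  f.continuous.integrable_of_hasCompactSupport (HasCompactSupport.of_compactSpace _)

lemma measure_ext_cont {μ ν : Measure X} [IsFiniteMeasure μ] [IsFiniteMeasure ν]
    (h : ∀ f : C(X, ℝ), ∫ x, f x ∂μ = ∫ x, f x ∂ν) : μ = ν :=
  ext_of_forall_integral_eq_of_IsFiniteMeasure (fun f => h f.toContinuousMap)

lemma exists_measure {T : C(X, X)} {x : X} {L : C(X, ℝ) → ℝ} (hL : L ∈ invMeans T x) :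
    ∃ μ : Measure X, IsProbabilityMeasure μ ∧ MeasurePreserving T μ μ ∧
      ∀ f : C(X, ℝ), ∫ x, f x ∂μ = L f := by
  have h1' := invMeans_one hL
  obtain ⟨h1, h2, h3, h4⟩ := hL
  let Λ₀ : CompactlySupportedContinuousMap X ℝ →ₗ[ℝ] ℝ :=
    { toFun := fun f => L f.toContinuousMap
      map_add' := fun f g => h1 _ _
      map_smul' := fun c f => h2 _ _ }
  let Λ : CompactlySupportedContinuousMap X ℝ →ₚ[ℝ] ℝ :=
    PositiveLinearMap.mk₀ Λ₀ (fun f hf => h4 _ 0 (fun n => hf _))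
  let μ := RealRMK.rieszMeasure Λ
  have hμ : ∀ f : C(X, ℝ), ∫ x, f x ∂μ = L f := fun f =>
    RealRMK.integral_rieszMeasure Λ (CompactlySupportedContinuousMap.continuousMapEquiv f)
  have hfin : IsFiniteMeasure μ := ⟨isCompact_univ.measure_lt_top⟩
  have hp : IsProbabilityMeasure μ := by
    have := hμ 1
    rw [h1'] at this
    simp at this
    exact ⟨by simpa [measureReal_def, ENNReal.toReal_eq_one_iff] using this⟩
  refine ⟨μ, hp, ⟨T.continuous.measurable, ?_⟩, hμ⟩
  have : IsFiniteMeasure (μ.map T) := by infer_instance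
  apply measure_ext_cont
  intro f
  rw [integral_map T.continuous.aemeasurable f.continuous.aestronglyMeasurable, hμ f, ← h3 f,
    ← hμ]
  rfl

/-- Birkhoff averages of a continuous function. -/
noncomputable def bavg (T : C(X, X)) (N : ℕ) (f : C(X, ℝ)) : C(X, ℝ) :=
  birkhoffAverage ℝ (fun g : C(X, ℝ) => g.comp T) id N f

lemma comp_iter_apply (T : C(X, X)) (i : ℕ) (f : C(X, ℝ)) (y : X) :
    ((fun g : C(X, ℝ) => g.comp T)^[i] f) y = f (T^[i] y) := by
  induction i generalizing f with
  | zero => rfl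
  | succ i ih =>
    rw [Function.iterate_succ_apply, ih, Function.iterate_succ_apply']
    rfl

lemma bavg_apply (T : C(X, X)) (N : ℕ) (f : C(X, ℝ)) (y : X) :
    bavg T N f y = (N : ℝ)⁻¹ * ∑ i ∈ Finset.range N, f (T^[i] y) := by
  simp [bavg, birkhoffAverage, birkhoffSum, comp_iter_apply]

lemma mean_ergodic {T : C(X, X)} {μ : Measure X} [IsProbabilityMeasure μ] (hT : Ergodic T μ)
    (f : C(X, ℝ)) :
    Tendsto (fun N => ∫ y, (bavg T N f y - ∫ z, f z ∂μ) ^ 2 ∂μ) atTop (𝓝 0) := by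
  let U : Lp ℝ 2 μ →L[ℝ] Lp ℝ 2 μ :=
    (Lp.compMeasurePreservingₗᵢ ℝ T hT.toMeasurePreserving).toContinuousLinearMap
  let J : C(X, ℝ) →L[ℝ] Lp ℝ 2 μ := ContinuousMap.toLp 2 μ ℝ
  have hUJ : ∀ g : C(X, ℝ), U (J g) = J (g.comp T) := by
    intro g
    apply Lp.ext
    have e1 : U (J g) =ᵐ[μ] (J g) ∘ T := Lp.coeFn_compMeasurePreserving _ _
    have e2 : J g =ᵐ[μ] g := ContinuousMap.coeFn_toLp μ g
    have e3 : J (g.comp T) =ᵐ[μ] g.comp T := ContinuousMap.coeFn_toLp μ _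
    have e4 := hT.toMeasurePreserving.quasiMeasurePreserving.ae_eq_comp e2
    exact e1.trans (e4.trans e3.symm)
  have hUJi : ∀ (i : ℕ) (g : C(X, ℝ)), U^[i] (J g) = J ((fun g : C(X, ℝ) => g.comp T)^[i] g) := by
    intro i
    induction i with
    | zero => intro g; rfl
    | succ i ih => intro g; rw [Function.iterate_succ_apply, hUJ, ih]; rfl
  have hB : ∀ N, birkhoffAverage ℝ U id N (J f) = J (bavg T N f) := by
    intro N
    simp only [bavg, birkhoffAverage, birkhoffSum, id, hUJi, map_smul, map_sum]
  have hU : ‖U‖ ≤ 1 := LinearIsometry.norm_toContinuousLinearMap_le _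
  have hlim := ContinuousLinearMap.tendsto_birkhoffAverage_orthogonalProjection U hU (J f)
  set h := (U.eqLocus (1 : Lp ℝ 2 μ →L[ℝ] Lp ℝ 2 μ)).orthogonalProjectionOnto (J f) with hh
  have hfix : U h.1 = h.1 := h.2
  obtain ⟨c, hc⟩ : ∃ c : ℝ, (h.1 : X → ℝ) =ᵐ[μ] Function.const X c := by
    apply hT.ae_eq_const_of_ae_eq_comp_ae (Lp.aestronglyMeasurable _)
    have e1 : U h.1 =ᵐ[μ] h.1 ∘ T := Lp.coeFn_compMeasurePreserving _ _
    rw [hfix] at e1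
    exact e1.symm
  have hhc : h.1 = J (ContinuousMap.const X c) := by
    apply Lp.ext
    exact hc.trans (ContinuousMap.coeFn_toLp μ (ContinuousMap.const X c)).symm
  have hnorm : ∀ g : C(X, ℝ), ‖J g‖ ^ 2 = ∫ y, g y ^ 2 ∂μ := by
    intro g
    rw [← real_inner_self_eq_norm_sq, L2.inner_def]
    apply integral_congr_ae
    have e2 : J g =ᵐ[μ] g := ContinuousMap.coeFn_toLp μ g
    filter_upwards [e2] with y hy
    rw [hy]; simp [sq]
  have hint : ∀ N, 0 < N → ∫ y, bavg T N f y ∂μ = ∫ z, f z ∂μ := by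
    intro N hN
    have : ∀ i, ∫ y, f (T^[i] y) ∂μ = ∫ z, f z ∂μ := by
      intro i
      have hm := hT.toMeasurePreserving.iterate i
      rw [← integral_map (φ := T^[i]) hm.measurable.aemeasurable
        f.continuous.aestronglyMeasurable, hm.map_eq]
    simp_rw [bavg_apply]
    rw [integral_const_mul, integral_finsetSum]
    · simp [this]; field_simp
    · intro i _
      exact integrable_cont μ (f.comp ⟨T^[i], T.continuous.iterate i⟩)
  have hlim2 : Tendsto (fun N => ∫ y, (bavg T N f y - c) ^ 2 ∂μ) atTop (𝓝 0) := by
    have : Tendsto (fun N => ‖birkhoffAverage ℝ U id N (J f) - h.1‖ ^ 2) atTop (𝓝 (0 ^ 2)) :=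
      (tendsto_iff_norm_sub_tendsto_zero.1 hlim).pow 2
    simp only [hB, hhc, ← map_sub, hnorm] at this
    simpa using this
  refine squeeze_zero' (Eventually.of_forall fun N => integral_nonneg fun y => sq_nonneg _) ?_ hlim2
  filter_upwards [eventually_gt_atTop 0] with N hN
  set m := ∫ z, f z ∂μ with hm
  have i1 : Integrable (fun y => (bavg T N f y - m) ^ 2) μ :=
    integrable_cont μ ((bavg T N f - ContinuousMap.const X m) ^ 2)
  have i2 : Integrable (fun y => bavg T N f y - m) μ :=
    integrable_cont μ (bavg T N f - ContinuousMap.const X m)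
  have e : ∫ y, (bavg T N f y - c) ^ 2 ∂μ = ∫ y, (bavg T N f y - m) ^ 2 ∂μ + (m - c) ^ 2 := by
    have : ∀ y, (bavg T N f y - c) ^ 2 =
      (bavg T N f y - m) ^ 2 + 2 * (m - c) * (bavg T N f y - m) + (m - c) ^ 2 := by
      intro y; ring
    simp_rw [this]
    have i3 : Integrable (fun y => (bavg T N f y - m) ^ 2 + 2 * (m - c) * (bavg T N f y - m)) μ :=
      i1.add (i2.const_mul _)
    rw [integral_add i3 (integrable_const _),
      integral_add i1 (i2.const_mul _), integral_const_mul,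
      integral_sub (integrable_cont μ _) (integrable_const _), hint N hN]
    simp
  rw [e]
  nlinarith [sq_nonneg (m - c)]

lemma mem_invMeans_of_dom {T : C(X, X)} {x : X} {L : C(X, ℝ) → ℝ} (hL : L ∈ invMeans T x)
    {ν : Measure X} [IsProbabilityMeasure ν] (hν : MeasurePreserving T ν ν) {s : ℝ} (hs : 0 < s)
    (hdom : ∀ h : C(X, ℝ), (∀ y, 0 ≤ h y) → s * ∫ y, h y ∂ν ≤ L h) :
    (fun f : C(X, ℝ) => ∫ y, f y ∂ν) ∈ invMeans T x := by
  obtain ⟨h1, h2, h3, h4⟩ := hL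
  refine ⟨fun f g => ?_, fun c f => ?_, fun f => ?_, fun f I hI => ?_⟩
  · exact integral_add (integrable_cont ν f) (integrable_cont ν g)
  · exact integral_const_mul c _
  · have := integral_map (μ := ν) (φ := T) (f := f) hν.measurable.aemeasurable
      f.continuous.aestronglyMeasurable
    rw [hν.map_eq] at this
    exact this.symm
  · let h : C(X, ℝ) := ⟨fun y => max (I - f y) 0, by fun_prop⟩
    have hz : L h ≤ 0 := by
      have := h4 ((-1 : ℝ) • h) 0 (fun n => by simp [h, hI n])
      rw [h2] at this
      linarith
    have hp := hdom h (fun y => le_max_right _ _)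
    have hq : ∫ y, h y ∂ν ≤ 0 := by
      by_contra hcon
      push Not at hcon
      nlinarith [mul_pos hs hcon]
    have : ∫ y, (I - f y) ∂ν ≤ ∫ y, h y ∂ν :=
      integral_mono ((integrable_const _).sub (integrable_cont ν f)) (integrable_cont ν h)
        (fun y => le_max_left _ _)
    rw [integral_sub (integrable_const _) (integrable_cont ν f)] at this
    simp at this
    linarith

lemma exists_ergodic (T : C(X, X)) (x : X) (c : C(X, ℝ)) (r : ℝ)
    (h : ∀ ε > 0, ∃ L ∈ invMeans T x, r - ε ≤ L c) :
    ∃ μ : Measure X, IsProbabilityMeasure μ ∧ Ergodic T μ ∧ r ≤ ∫ y, c y ∂μ ∧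
      ∀ (f : C(X, ℝ)) (I : ℝ), (∀ n : ℕ, I ≤ f (T^[n] x)) → I ≤ ∫ y, f y ∂μ := by
  have hK := invMeans_compact T x
  have hne : (invMeans T x).Nonempty := by
    obtain ⟨L, hL, -⟩ := h 1 one_pos
    exact ⟨L, hL⟩
  obtain ⟨L0, hL0, hmax⟩ := hK.exists_isMaxOn hne
    (f := fun L : C(X, ℝ) → ℝ => L c) (by fun_prop)
  have hmax' : ∀ L ∈ invMeans T x, L c ≤ L0 c := fun L hL => hmax hL
  let F : Set (C(X, ℝ) → ℝ) := invMeans T x ∩ {L | L c = L0 c}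
  have hF : IsCompact F := hK.inter_right (isClosed_eq (by fun_prop) (by fun_prop))
  obtain ⟨L, hLext⟩ := hF.extremePoints_nonempty ⟨L0, hL0, rfl⟩
  have hLF : L ∈ F := hLext.1
  obtain ⟨μ, hp, hinv, hμ⟩ := exists_measure hLF.1
  refine ⟨μ, hp, ?_, ?_, ?_⟩
  · apply Ergodic.of_mem_extremePoints
    rw [mem_extremePoints_iff_left]
    refine ⟨⟨hinv, hp⟩, ?_⟩
    rintro ν₁ ⟨hi₁, hp₁⟩ ν₂ ⟨hi₂, hp₂⟩ ⟨a, b, ha, hb, hab, rfl⟩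
    have ha' : a ≠ ⊤ := by
      intro h; simp [h] at hab
    have hb' : b ≠ ⊤ := by
      intro h; simp [h] at hab
    have hs : 0 < a.toReal := ENNReal.toReal_pos ha.ne' ha'
    have ht : 0 < b.toReal := ENNReal.toReal_pos hb.ne' hb'
    have hst : a.toReal + b.toReal = 1 := by
      rw [← ENNReal.toReal_add ha' hb', hab]; simp
    have key : ∀ f : C(X, ℝ), L f = a.toReal * ∫ y, f y ∂ν₁ + b.toReal * ∫ y, f y ∂ν₂ := by
      intro f
      rw [← hμ f, integral_add_measure ((integrable_cont ν₁ f).smul_measure ha')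
        ((integrable_cont ν₂ f).smul_measure hb'), integral_smul_measure, integral_smul_measure]
      rfl
    have m1 := mem_invMeans_of_dom hLF.1 hi₁ hs (fun h hh => by
      rw [key h]
      have : 0 ≤ ∫ y, h y ∂ν₂ := integral_nonneg hh
      nlinarith)
    have m2 := mem_invMeans_of_dom hLF.1 hi₂ ht (fun h hh => by
      rw [key h]
      have : 0 ≤ ∫ y, h y ∂ν₁ := integral_nonneg hh
      nlinarith)
    have c1 := hmax' _ m1
    have c2 := hmax' _ m2
    have c3 : L c = L0 c := hLF.2
    rw [key c] at c3
    have d1 : ∫ y, c y ∂ν₁ = L0 c := by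
      apply le_antisymm c1
      have h5 := mul_le_mul_of_nonneg_left c2 ht.le
      have hb2 : b.toReal = 1 - a.toReal := by linarith
      rw [hb2] at h5 c3
      by_contra hcon
      push Not at hcon
      nlinarith [mul_lt_mul_of_pos_left hcon hs]
    have d2 : ∫ y, c y ∂ν₂ = L0 c := by
      rw [d1] at c3
      have ha2 : a.toReal = 1 - b.toReal := by linarith
      rw [ha2] at c3
      have h6 : b.toReal * (∫ y, c y ∂ν₂ - L0 c) = 0 := by linarith
      rcases mul_eq_zero.1 h6 with h7 | h7
      · exact absurd h7 ht.ne'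
      · linarith
    have := (mem_extremePoints_iff_left.1 hLext).2 _ ⟨m1, d1⟩ _ ⟨m2, d2⟩
      ⟨a.toReal, b.toReal, hs, ht, hst, by
        funext f
        simp [key f]⟩
    apply measure_ext_cont
    intro f
    rw [hμ f, ← this]
  · rw [hμ, show L c = L0 c from hLF.2]
    apply le_of_forall_pos_le_add
    intro ε hε
    obtain ⟨L', hL', hr⟩ := h ε hε
    linarith [hmax' L' hL']
  · intro f I hI
    rw [hμ]
    exact hLF.1.2.2.2 f I hI

lemma exists_window {T : C(X, X)} {x : X} {μ : Measure X} [IsProbabilityMeasure μ]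
    (hT : Ergodic T μ)
    (hsupp : ∀ (f : C(X, ℝ)) (I : ℝ), (∀ n : ℕ, I ≤ f (T^[n] x)) → I ≤ ∫ y, f y ∂μ)
    (F : ℕ → C(X, ℝ)) (j : ℕ) :
    ∃ p : ℕ × ℕ, j < p.2 ∧ ∀ i ≤ j,
      |bavg T p.2 (F i) (T^[p.1] x) - ∫ z, F i z ∂μ| < 1 / ((j : ℝ) + 1) := by
  have hε : (0 : ℝ) < 1 / ((j : ℝ) + 1) := by positivity
  set ε := 1 / ((j : ℝ) + 1)
  have h1 : Tendsto (fun N => ∑ i ∈ Finset.range (j + 1),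
      ∫ y, (bavg T N (F i) y - ∫ z, F i z ∂μ) ^ 2 ∂μ) atTop (𝓝 0) := by
    simpa using tendsto_finsetSum (Finset.range (j + 1)) (fun i _ => mean_ergodic hT (F i))
  obtain ⟨N, hN1, hN2⟩ :=
    ((h1.eventually_lt_const (pow_pos hε 2)).and (eventually_gt_atTop j)).exists
  let g : C(X, ℝ) := ∑ i ∈ Finset.range (j + 1),
    (bavg T N (F i) - ContinuousMap.const X (∫ z, F i z ∂μ)) ^ 2
  have hg : ∀ y, g y = ∑ i ∈ Finset.range (j + 1), (bavg T N (F i) y - ∫ z, F i z ∂μ) ^ 2 := by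
    intro y; simp [g]
  have hgi : ∫ y, g y ∂μ = ∑ i ∈ Finset.range (j + 1),
      ∫ y, (bavg T N (F i) y - ∫ z, F i z ∂μ) ^ 2 ∂μ := by
    simp_rw [hg]
    rw [integral_finsetSum]
    intro i _
    exact integrable_cont μ ((bavg T N (F i) - ContinuousMap.const X (∫ z, F i z ∂μ)) ^ 2)
  obtain ⟨n, hn⟩ : ∃ n : ℕ, g (T^[n] x) < ε ^ 2 := by
    by_contra hcon
    push Not at hcon
    have := hsupp g _ hcon
    rw [hgi] at this
    linarith
  refine ⟨(n, N), hN2, fun i hi => ?_⟩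
  apply abs_lt_of_sq_lt_sq _ hε.le
  refine lt_of_le_of_lt ?_ hn
  rw [hg]
  exact Finset.single_le_sum
    (f := fun i => (bavg T N (F i) (T^[n] x) - ∫ z, F i z ∂μ) ^ 2)
    (fun i _ => sq_nonneg _) (Finset.mem_range.2 (by omega))

lemma folner_windows (p : ℕ → ℕ × ℕ) (hp : ∀ j, j < (p j).2) :
    IsFolnerSeq (fun j => Finset.Ico (p j).1 ((p j).1 + (p j).2)) := by
  refine ⟨fun N => ?_, fun t => ?_⟩
  · have := hp N
    simp; omega
  · have hlim : Tendsto (fun j : ℕ => 1 - (t : ℝ) / (j : ℝ)) atTop (𝓝 1) := by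
      simpa using (tendsto_const_div_atTop_nhds_zero_nat (t : ℝ)).const_sub 1
    refine tendsto_of_tendsto_of_tendsto_of_le_of_le' hlim tendsto_const_nhds ?_ ?_
    · filter_upwards [eventually_gt_atTop 0] with j hj
      have hL := hp j
      rw [Finset.image_add_left_Ico, Finset.Ico_inter_Ico, Nat.card_Ico, Nat.card_Ico]
      have hj' : (0 : ℝ) < j := by exact_mod_cast hj
      have hL' : (j : ℝ) < (p j).2 := by exact_mod_cast hL
      have e : (p j).1 + (p j).2 - (p j).1 = (p j).2 := by omega
      rw [e]
      have e2 : ((p j).2 : ℝ) ≤ ((min ((p j).1 + (p j).2) (t + ((p j).1 + (p j).2)) -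
          max (p j).1 (t + (p j).1) : ℕ) : ℝ) + t := by
        exact_mod_cast (by omega)
      have hLpos : (0 : ℝ) < (p j).2 := by linarith
      have : (t : ℝ) / (p j).2 ≤ t / j := by gcongr
      rw [le_div_iff₀ hLpos]
      have h3 : (1 - (t : ℝ) / j) * (p j).2 ≤ (1 - (t : ℝ) / (p j).2) * (p j).2 := by gcongr
      have h4 : (1 - (t : ℝ) / (p j).2) * (p j).2 = (p j).2 - t := by field_simp
      linarith
    · refine Eventually.of_forall fun j => ?_
      apply div_le_one_of_le₀ _ (by positivity)
      exact_mod_cast Finset.card_le_card Finset.inter_subset_left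

lemma window_avg (T : C(X, X)) (x : X) (f : C(X, ℝ)) (n L : ℕ) :
    (∑ i ∈ Finset.Ico n (n + L), f (T^[i] x)) / ((Finset.Ico n (n + L)).card : ℝ) =
      bavg T L f (T^[n] x) := by
  rw [bavg_apply, Finset.sum_Ico_eq_sum_range, Nat.card_Ico]
  simp only [Nat.add_sub_cancel_left]
  rw [div_eq_inv_mul]
  congr 1
  refine Finset.sum_congr rfl fun i _ => ?_
  rw [← Function.iterate_add_apply, add_comm]

lemma bavg_dist (T : C(X, X)) (f g : C(X, ℝ)) (L : ℕ) (hL : 0 < L) (y : X) :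
    |bavg T L f y - bavg T L g y| ≤ ‖f - g‖ := by
  have hL' : (0 : ℝ) < L := by exact_mod_cast hL
  rw [bavg_apply, bavg_apply, ← mul_sub, ← Finset.sum_sub_distrib, abs_mul,
    abs_of_pos (inv_pos.2 hL'), inv_mul_le_iff₀ hL']
  refine (Finset.abs_sum_le_sum_abs _ _).trans ?_
  refine (Finset.sum_le_card_nsmul _ _ ‖f - g‖ fun i _ => ?_).trans (by simp)
  exact (f - g).norm_coe_le_norm _

lemma exists_generic {T : C(X, X)} {x : X} {μ : Measure X} [IsProbabilityMeasure μ]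
    (hT : Ergodic T μ)
    (hsupp : ∀ (f : C(X, ℝ)) (I : ℝ), (∀ n : ℕ, I ≤ f (T^[n] x)) → I ≤ ∫ y, f y ∂μ) :
    ∃ Φ : ℕ → Finset ℕ, IsFolnerSeq Φ ∧ GenericAlong T μ x Φ := by
  let F := TopologicalSpace.denseSeq C(X, ℝ)
  choose p hp1 hp2 using exists_window hT hsupp F
  refine ⟨_, folner_windows p hp1, fun f => ?_⟩
  simp only [window_avg]
  rw [Metric.tendsto_atTop]
  intro ε hε
  obtain ⟨i, hi⟩ := (TopologicalSpace.denseRange_denseSeq C(X, ℝ)).exists_dist_lt f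
    (show 0 < ε / 4 by positivity)
  rw [dist_eq_norm] at hi
  obtain ⟨M, hM⟩ := exists_nat_one_div_lt (show 0 < ε / 4 by positivity)
  refine ⟨max i M, fun j hj => ?_⟩
  have h1 := hp2 j i (le_trans (le_max_left _ _) hj)
  have h2 := bavg_dist T f (F i) (p j).2 (lt_of_le_of_lt (Nat.zero_le _) (hp1 j)) (T^[(p j).1] x)
  have h3 : |∫ y, F i y ∂μ - ∫ y, f y ∂μ| ≤ ‖f - F i‖ := by
    rw [← integral_sub (integrable_cont μ _) (integrable_cont μ _)]
    have := norm_integral_le_of_norm_le_const (μ := μ) (f := fun y => F i y - f y)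
      (C := ‖f - F i‖) (Eventually.of_forall fun y => by
        rw [norm_sub_rev]
        exact (f - F i).norm_coe_le_norm y)
    simpa using this
  have h4 : 1 / ((j : ℝ) + 1) ≤ 1 / ((M : ℝ) + 1) := by
    have : (M : ℝ) ≤ j := by exact_mod_cast le_trans (le_max_right _ _) hj
    gcongr
  have hi' : ‖f - F i‖ < ε / 4 := hi
  rw [Real.dist_eq]
  rw [abs_lt] at h1 ⊢
  rw [abs_le] at h2 h3
  constructor <;> linarith [h1.1, h1.2, h2.1, h2.2, h3.1, h3.2]

lemma exists_mean (T : C(X, X)) (x : X) (U : Ultrafilter ℕ) (w : ℕ → ℕ)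
    (hw : Tendsto w U atTop) :
    ∃ L ∈ invMeans T x, ∀ f : C(X, ℝ),
      Tendsto (fun q => bavg T (w q) f (T x)) U (𝓝 (L f)) := by
  have hb : ∀ (N : ℕ) (f : C(X, ℝ)) (y : X), |bavg T N f y| ≤ ‖f‖ := by
    intro N f y
    rcases Nat.eq_zero_or_pos N with rfl | hN
    · simp [bavg_apply]
    · have h0 := bavg_dist T f 0 N hN y
      have h1 : bavg T N 0 y = 0 := by simp [bavg_apply]
      simpa [h1] using h0
  have hex : ∀ f : C(X, ℝ), ∃ l : ℝ, Tendsto (fun q => bavg T (w q) f (T x)) U (𝓝 l) := by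
    intro f
    obtain ⟨l, -, hl⟩ := (isCompact_Icc (a := -‖f‖) (b := ‖f‖)).ultrafilter_le_nhds
      (U.map (fun q => bavg T (w q) f (T x))) (by
        simp only [le_principal_iff]
        exact Filter.Eventually.of_forall (f := (U : Filter ℕ)) fun q => abs_le.1 (hb _ _ _))
    exact ⟨l, hl⟩
  choose L hL using hex
  have hpos : ∀ᶠ q in (U : Filter ℕ), 0 < w q := hw.eventually_gt_atTop 0
  refine ⟨L, ⟨fun f g => ?_, fun c f => ?_, fun f => ?_, fun f I hI => ?_⟩, hL⟩
  · refine tendsto_nhds_unique (hL (f + g)) (((hL f).add (hL g)).congr fun q => ?_)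
    simp [bavg_apply, Finset.sum_add_distrib, mul_add]
  · refine tendsto_nhds_unique (hL (c • f)) (((hL f).const_mul c).congr fun q => ?_)
    simp only [bavg_apply, ContinuousMap.smul_apply, smul_eq_mul, ← Finset.mul_sum]
    ring
  · have hz : Tendsto (fun q => (w q : ℝ)⁻¹ * (2 * ‖f‖)) U (𝓝 0) := by
      have : Tendsto (fun q => (w q : ℝ)⁻¹) U (𝓝 0) :=
        tendsto_inv_atTop_nhds_zero_nat.comp hw
      simpa using this.mul_const (2 * ‖f‖)
    have hd : Tendsto (fun q => bavg T (w q) (f.comp T) (T x) - bavg T (w q) f (T x)) U (𝓝 0) := by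
      refine squeeze_zero_norm (fun q => ?_) hz
      rw [bavg_apply, bavg_apply, ← mul_sub, ← Finset.sum_sub_distrib]
      have : ∑ i ∈ Finset.range (w q), ((f.comp T) (T^[i] (T x)) - f (T^[i] (T x))) =
          f (T^[w q] (T x)) - f (T^[0] (T x)) := by
        rw [← Finset.sum_range_sub (fun i => f (T^[i] (T x)))]
        refine Finset.sum_congr rfl fun i _ => ?_
        rw [Function.iterate_succ_apply']
        rfl
      rw [this, norm_mul, Real.norm_of_nonneg (by positivity)]
      gcongr
      refine (norm_sub_le _ _).trans ?_
      linarith [f.norm_coe_le_norm (T^[w q] (T x)), f.norm_coe_le_norm (T^[0] (T x))]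
    have := tendsto_nhds_unique hd ((hL (f.comp T)).sub (hL f))
    linarith
  · refine ge_of_tendsto (hL f) ?_
    filter_upwards [hpos] with q hq
    have hq' : (0 : ℝ) < w q := by exact_mod_cast hq
    rw [bavg_apply, le_inv_mul_iff₀ hq']
    have := Finset.card_nsmul_le_sum (Finset.range (w q)) (fun i => f (T^[i] (T x))) I
      (fun i _ => by
        rw [← Function.iterate_succ_apply]
        exact hI _)
    simpa using this

end General

lemma shiftS_iter (n : ℕ) (b : BinSeq) (z : ℤ) : shiftS^[n] b z = b (z + n) := by
  induction n generalizing b with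
  | zero => simp
  | succ n ih =>
    rw [Function.iterate_succ_apply, ih]
    simp only [shiftS]
    push_cast
    congr 1
    ring

/-- The product shift as a continuous map. -/
def prodShift : C(BinSeq × BinSeq, BinSeq × BinSeq) :=
  ⟨fun p => (shiftS p.1, shiftS p.2), by
    unfold shiftS
    fun_prop⟩

lemma prodShift_iter (n : ℕ) (p : BinSeq × BinSeq) :
    prodShift^[n] p = (shiftS^[n] p.1, shiftS^[n] p.2) := by
  induction n generalizing p with
  | zero => rfl
  | succ n ih => rw [Function.iterate_succ_apply, ih]; rfl

/-- Indicator of `x 0 = 1`. -/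
noncomputable def indE : C(BinSeq, ℝ) :=
  ⟨fun x => if x 0 = true then 1 else 0,
    (continuous_of_discreteTopology (f := fun b : Bool => if b = true then (1 : ℝ) else 0)).comp
      (continuous_apply (0 : ℤ))⟩

lemma isOpen_E : IsOpen {x : BinSeq | x 0 = true} :=
  (isOpen_discrete ({true} : Set Bool)).preimage
    (show Continuous (fun x : BinSeq => x 0) from continuous_apply (0 : ℤ))

open scoped Classical in
/-- Lower bound for one coordinate. -/
lemma avg_bound (b : BinSeq) (W M : ℕ) (hW : 0 < W)
    (hc : ((Finset.range W).filter (fun n : ℕ => b ((n : ℤ) + 1) = false)).card ≤ M) :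
    1 - (M : ℝ) / W ≤ (W : ℝ)⁻¹ * ∑ n ∈ Finset.range W, indE (shiftS^[n] (shiftS b)) := by
  have hW' : (0 : ℝ) < W := by exact_mod_cast hW
  rw [le_inv_mul_iff₀ hW']
  have e1 : (W : ℝ) * (1 - M / W) = W - M := by field_simp
  rw [e1]
  have e2 : ∀ n : ℕ, indE (shiftS^[n] (shiftS b)) =
      1 - (if b ((n : ℤ) + 1) = false then (1 : ℝ) else 0) := by
    intro n
    rw [← Function.iterate_succ_apply]
    simp only [indE, ContinuousMap.coe_mk, shiftS_iter]
    have e0 : (0 : ℤ) + ((n.succ : ℕ) : ℤ) = (n : ℤ) + 1 := by push_cast; ring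
    simp only [e0]
    cases b ((n : ℤ) + 1) <;> simp
  simp_rw [e2]
  rw [Finset.sum_sub_distrib, Finset.sum_boole]
  have : (((Finset.range W).filter (fun n : ℕ => b ((n : ℤ) + 1) = false)).card : ℝ) ≤ M := by
    exact_mod_cast hc
  simp only [Finset.sum_const, Finset.card_range, nsmul_eq_mul, mul_one]
  linarith

open scoped Classical in
/-- The point `a`. -/
noncomputable def ptA (A : Set ℕ) : BinSeq := fun z => decide (z.toNat ∈ A)

open scoped Classical in
/-- The first point of the pair. -/
noncomputable def ptA2 (A : Set ℕ) (ℓ m : ℕ) : BinSeq := fun z =>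
  if (ℓ : ℤ) ∣ z then decide (z.toNat / ℓ * (ℓ + m) ∈ A) else true

open scoped Classical in
lemma count1 (A : Set ℕ) (ℓ m N : ℕ) :
    ((Finset.range (N / (ℓ + m) * ℓ)).filter
      (fun n : ℕ => ptA A ((n : ℤ) + 1) = false)).card ≤
      ((Finset.Icc 1 N).filter (fun j => ¬ j ∈ A)).card := by
  apply Finset.card_le_card_of_injOn (fun n => n + 1)
  · intro n hn
    simp only [Finset.coe_filter, Finset.mem_range, Set.mem_ofPred_eq, ptA,
      decide_eq_false_iff_not, Finset.mem_Icc] at hn ⊢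
    have h1 : N / (ℓ + m) * (ℓ + m) ≤ N := Nat.div_mul_le_self _ _
    have h2 : N / (ℓ + m) * ℓ ≤ N / (ℓ + m) * (ℓ + m) := Nat.mul_le_mul_left _ (by omega)
    refine ⟨by omega, ?_⟩
    have := hn.2
    rwa [show ((n : ℤ) + 1).toNat = n + 1 by omega] at this
  · intro a _ b _ h
    simpa using h

open scoped Classical in
lemma count2 (A : Set ℕ) (ℓ m N : ℕ) (hℓ : 0 < ℓ) :
    ((Finset.range (N / (ℓ + m) * ℓ)).filter
      (fun n : ℕ => ptA2 A ℓ m ((n : ℤ) + 1) = false)).card ≤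
      ((Finset.Icc 1 N).filter (fun j => ¬ j ∈ A)).card := by
  have hchar : ∀ n : ℕ, ptA2 A ℓ m ((n : ℤ) + 1) = false →
      ℓ ∣ n + 1 ∧ ¬ (n + 1) / ℓ * (ℓ + m) ∈ A := by
    intro n hn
    unfold ptA2 at hn
    split_ifs at hn with hd
    refine ⟨by exact_mod_cast hd, ?_⟩
    rw [show ((n : ℤ) + 1).toNat = n + 1 by omega] at hn
    simpa using hn
  apply Finset.card_le_card_of_injOn (fun n => (n + 1) / ℓ * (ℓ + m))
  · intro n hn
    simp only [Finset.coe_filter, Finset.mem_range, Set.mem_ofPred_eq, Finset.mem_Icc] at hn ⊢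
    obtain ⟨⟨t, ht⟩, hA⟩ := hchar n hn.2
    refine ⟨?_, hA⟩
    rw [ht, Nat.mul_div_cancel_left _ hℓ]
    have ht0 : 0 < t := by
      rcases Nat.eq_zero_or_pos t with rfl | h
      · simp at ht
      · exact h
    have hq : t ≤ N / (ℓ + m) := by
      have h1 : ℓ * t ≤ ℓ * (N / (ℓ + m)) := by
        rw [mul_comm ℓ (N / (ℓ + m))]
        omega
      exact Nat.le_of_mul_le_mul_left h1 hℓ
    constructor
    · exact Nat.mul_pos ht0 (by omega)
    · exact (Nat.mul_le_mul_right _ hq).trans (Nat.div_mul_le_self _ _)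
  · intro a ha b hb h
    simp only [Finset.coe_filter, Finset.mem_range, Set.mem_ofPred_eq] at ha hb
    obtain ⟨⟨s, hs⟩, -⟩ := hchar a ha.2
    obtain ⟨⟨t, ht⟩, -⟩ := hchar b hb.2
    simp only [hs, ht, Nat.mul_div_cancel_left _ hℓ] at h
    have := Nat.eq_of_mul_eq_mul_right (by omega) h
    subst this
    omega

open scoped Classical in
lemma missing_bound (A : Set ℕ) (N : ℕ) (s : ℝ) (hN : 0 < N)
    (h : s < (((Finset.Icc 1 N).filter (· ∈ A)).card : ℝ) / N) :
    s ≤ 1 ∧ (((Finset.Icc 1 N).filter (fun j => ¬ j ∈ A)).card : ℝ) ≤ (1 - s) * N := by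
  have hN' : (0 : ℝ) < N := by exact_mod_cast hN
  have h1 := Finset.card_filter_add_card_filter_not (s := Finset.Icc 1 N) (fun j => j ∈ A)
  rw [Nat.card_Icc] at h1
  have h2 : (((Finset.Icc 1 N).filter (· ∈ A)).card : ℝ) +
      (((Finset.Icc 1 N).filter (fun j => ¬ j ∈ A)).card : ℝ) = N := by
    exact_mod_cast h1
  rw [lt_div_iff₀ hN'] at h
  have h3 : (0 : ℝ) ≤ (((Finset.Icc 1 N).filter (fun j => ¬ j ∈ A)).card : ℝ) := by positivity
  constructor
  · by_contra hcon
    push Not at hcon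
    nlinarith
  · linarith

open scoped Classical in
lemma exists_good_mean (A : Set ℕ) (ℓ m : ℕ) (hℓ : 0 < ℓ)
    (k : ℝ) (hk : k = (m : ℝ) / ℓ) (η : ℝ) (hη : 0 < η) :
    ∃ L ∈ invMeans prodShift (ptA2 A ℓ m, ptA A),
      (k + 1) * (upperDensity A - η) - k ≤ L (indE.comp ContinuousMap.fst) ∧
      (k + 1) * (upperDensity A - η) - k ≤ L (indE.comp ContinuousMap.snd) := by
  set s := upperDensity A - η with hs
  have hfreq : ∃ᶠ N : ℕ in atTop, s < (((Finset.Icc 1 N).filter (· ∈ A)).card : ℝ) / N := by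
    apply frequently_lt_of_lt_limsup
    · refine ⟨0, fun a ha => ?_⟩
      obtain ⟨N, hN⟩ := (Filter.eventually_map.1 ha).exists
      exact le_trans (by positivity) hN
    · change s < upperDensity A
      linarith
  set G : Set ℕ := {N : ℕ | s < (((Finset.Icc 1 N).filter (· ∈ A)).card : ℝ) / N} with hG
  have hne : (atTop ⊓ 𝓟 G).NeBot := frequently_mem_iff_neBot.1 hfreq
  let U := Ultrafilter.of (atTop ⊓ 𝓟 G)
  have hU : (U : Filter ℕ) ≤ atTop ⊓ 𝓟 G := Ultrafilter.of_le _
  have hU1 : (U : Filter ℕ) ≤ atTop := hU.trans inf_le_left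
  have hU2 : ∀ᶠ N in (U : Filter ℕ), N ∈ G := le_principal_iff.1 (hU.trans inf_le_right)
  have hq : Tendsto (fun N : ℕ => N / (ℓ + m)) (U : Filter ℕ) atTop :=
    (Nat.tendsto_div_const_atTop (by omega)).mono_left hU1
  have hw : Tendsto (fun N : ℕ => N / (ℓ + m) * ℓ) (U : Filter ℕ) atTop :=
    tendsto_atTop_mono (fun N => Nat.le_mul_of_pos_right _ hℓ) hq
  obtain ⟨L, hL, hlim⟩ := exists_mean prodShift (ptA2 A ℓ m, ptA A) U _ hw
  have hℓ' : (0 : ℝ) < ℓ := by exact_mod_cast hℓ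
  have hlow : Tendsto (fun N : ℕ => 1 - (1 - s) * ((k + 1) *
      (1 + (((N / (ℓ + m) : ℕ) : ℝ))⁻¹))) (U : Filter ℕ) (𝓝 (1 - (1 - s) * ((k + 1) * (1 + 0)))) := by
    have : Tendsto (fun N : ℕ => (((N / (ℓ + m) : ℕ) : ℝ))⁻¹) (U : Filter ℕ) (𝓝 0) :=
      tendsto_inv_atTop_nhds_zero_nat.comp hq
    exact (((this.const_add 1).const_mul _).const_mul _).const_sub _
  have hval : 1 - (1 - s) * ((k + 1) * (1 + 0)) = (k + 1) * s - k := by ring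
  rw [hval] at hlow
  have hev : ∀ᶠ N in (U : Filter ℕ), 0 < N / (ℓ + m) * ℓ ∧
      1 - (1 - s) * ((k + 1) * (1 + (((N / (ℓ + m) : ℕ) : ℝ))⁻¹)) ≤
      1 - (((Finset.Icc 1 N).filter (fun j => ¬ j ∈ A)).card : ℝ) /
        ((N / (ℓ + m) * ℓ : ℕ) : ℝ) := by
    filter_upwards [hU2, hq.eventually_gt_atTop 0] with N hN hN0
    have hNpos : 0 < N := by
      rcases Nat.eq_zero_or_pos N with rfl | h
      · simp at hN0
      · exact h
    obtain ⟨hs1, hmiss⟩ := missing_bound A N s hNpos hN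
    refine ⟨Nat.mul_pos hN0 hℓ, ?_⟩
    set q := N / (ℓ + m) with hqdef
    have hq' : (0 : ℝ) < q := by exact_mod_cast hN0
    have hNle : (N : ℝ) ≤ (q + 1) * (ℓ + m) := by
      have := Nat.lt_div_mul_add (a := N) (b := ℓ + m) (by omega)
      have h2 : N ≤ (q + 1) * (ℓ + m) := by
        rw [add_mul, one_mul]; exact this.le
      exact_mod_cast h2
    apply sub_le_sub_left
    push_cast
    rw [div_le_iff₀ (by positivity)]
    refine hmiss.trans ?_
    have e : (1 - s) * ((k + 1) * (1 + (q : ℝ)⁻¹)) * (q * ℓ) = (1 - s) * ((q + 1) * (ℓ + m)) := by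
      rw [hk]
      field_simp
      ring
    rw [e]
    exact mul_le_mul_of_nonneg_left hNle (by linarith)
  refine ⟨L, hL, ?_, ?_⟩
  · refine le_of_tendsto_of_tendsto hlow (hlim _) ?_
    filter_upwards [hev] with N hN
    refine hN.2.trans ?_
    rw [bavg_apply]
    refine (avg_bound (ptA2 A ℓ m) _ _ hN.1 (count2 A ℓ m N hℓ)).trans (le_of_eq ?_)
    congr 1
    refine Finset.sum_congr rfl fun i _ => ?_
    rw [prodShift_iter]
    rfl
  · refine le_of_tendsto_of_tendsto hlow (hlim _) ?_
    filter_upwards [hev] with N hN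
    refine hN.2.trans ?_
    rw [bavg_apply]
    refine (avg_bound (ptA A) _ _ hN.1 (count1 A ℓ m N)).trans (le_of_eq ?_)
    congr 1
    refine Finset.sum_congr rfl fun i _ => ?_
    rw [prodShift_iter]
    rfl

lemma integral_ind (μ : Measure (BinSeq × BinSeq)) (S : Set (BinSeq × BinSeq))
    (hS : MeasurableSet S) (f : C(BinSeq × BinSeq, ℝ))
    (hf : ∀ p, f p = S.indicator (fun _ => (1 : ℝ)) p) : ∫ p, f p ∂μ = (μ S).toReal := by
  simp_rw [hf]
  rw [integral_indicator_const _ hS]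
  simp [measureReal_def]

/-- **Correspondence principle for unshifted unrestricted sumsets.** -/
theorem correspondence_no_shift (A : Set ℕ) (ℓ m : ℕ) (hℓ : 0 < ℓ) (hm : 0 < m)
    (k : ℝ) (hk : k = (m : ℝ) / ℓ) :
    ∃ (μ : Measure (BinSeq × BinSeq)) (E : Set BinSeq) (a'' a : BinSeq)
      (Φ : ℕ → Finset ℕ),
      IsProbabilityMeasure μ ∧
      Ergodic (fun p : BinSeq × BinSeq => (shiftS p.1, shiftS p.2)) μ ∧
      IsOpen E ∧ IsFolnerSeq Φ ∧
      GenericAlong (fun p : BinSeq × BinSeq => (shiftS p.1, shiftS p.2)) μ (a'', a) Φ ∧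
      ((ℓ : ℝ) + m) * (μ (Set.univ ×ˢ E)).toReal
          + ℓ * (μ (E ×ˢ (Set.univ : Set BinSeq))).toReal
        ≥ (2 * (ℓ : ℝ) + m) * ((k + 1) * upperDensity A - k) ∧
      A = {n : ℕ | shiftS^[n] a ∈ E} ∧
      {n : ℕ | n * (ℓ + m) ∈ A} = {n : ℕ | shiftS^[ℓ * n] a'' ∈ E} := by
  have hℓ' : (0 : ℝ) < ℓ := by exact_mod_cast hℓ
  have hm' : (0 : ℝ) < m := by exact_mod_cast hm
  have hk0 : 0 < k := by rw [hk]; positivity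
  let g1 : C(BinSeq × BinSeq, ℝ) := indE.comp ContinuousMap.fst
  let g2 : C(BinSeq × BinSeq, ℝ) := indE.comp ContinuousMap.snd
  let c : C(BinSeq × BinSeq, ℝ) := ((ℓ : ℝ) + m) • g2 + (ℓ : ℝ) • g1
  obtain ⟨μ, hp, herg, hr, hsupp⟩ := exists_ergodic prodShift (ptA2 A ℓ m, ptA A) c
    ((2 * (ℓ : ℝ) + m) * ((k + 1) * upperDensity A - k)) (by
      intro ε hε
      have hD : 0 < (2 * (ℓ : ℝ) + m) * (k + 1) := by positivity
      obtain ⟨L, hL, h1, h2⟩ := exists_good_mean A ℓ m hℓ k hk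
        (ε / ((2 * (ℓ : ℝ) + m) * (k + 1))) (by positivity)
      refine ⟨L, hL, ?_⟩
      change _ ≤ L (((ℓ : ℝ) + m) • g2 + (ℓ : ℝ) • g1)
      rw [hL.1, hL.2.1, hL.2.1]
      have e1 := mul_le_mul_of_nonneg_left h2 (show 0 ≤ (ℓ : ℝ) + m by positivity)
      have e2 := mul_le_mul_of_nonneg_left h1 hℓ'.le
      have e3 : (2 * (ℓ : ℝ) + m) * (k + 1) * (ε / ((2 * (ℓ : ℝ) + m) * (k + 1))) = ε :=
        mul_div_cancel₀ _ hD.ne'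
      change _ ≤ _ * L g2 at e1
      change _ ≤ _ * L g1 at e2
      nlinarith)
  obtain ⟨Φ, hΦ, hgen⟩ := exists_generic herg hsupp
  refine ⟨μ, {x | x 0 = true}, ptA2 A ℓ m, ptA A, Φ, hp, herg, isOpen_E, hΦ, hgen, ?_, ?_, ?_⟩
  · have i1 : ∫ p, g1 p ∂μ = (μ ({x : BinSeq | x 0 = true} ×ˢ (Set.univ : Set BinSeq))).toReal := by
      apply integral_ind _ _ (isOpen_E.measurableSet.prod MeasurableSet.univ)
      intro p
      simp [g1, indE, Set.indicator_apply]
    have i2 : ∫ p, g2 p ∂μ = (μ ((Set.univ : Set BinSeq) ×ˢ {x : BinSeq | x 0 = true})).toReal := by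
      apply integral_ind _ _ (MeasurableSet.univ.prod isOpen_E.measurableSet)
      intro p
      simp [g2, indE, Set.indicator_apply]
    have i3 : ∫ p, c p ∂μ = ((ℓ : ℝ) + m) * ∫ p, g2 p ∂μ + ℓ * ∫ p, g1 p ∂μ := by
      rw [← integral_const_mul, ← integral_const_mul, ← integral_add
        ((integrable_cont μ g2).const_mul _) ((integrable_cont μ g1).const_mul _)]
      rfl
    rw [← i1, ← i2, ← i3]
    exact hr
  · ext n
    simp [shiftS_iter, ptA]
  · ext n
    have : ((ℓ : ℤ) * n).toNat = ℓ * n := by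
      rw [← Nat.cast_mul, Int.toNat_natCast]
    simp [shiftS_iter, ptA2, this, Nat.mul_div_cancel_left _ hℓ]
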